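/- arXiv:1501.03445 — 5 statements merged into one kernel-verified Lean document; each statement's English description precedes it below -/
import Mathlib

section
/- Fix q ∈ (0,1), ν ∈ [0,1) and R ≥ 0. For all positive integers m and y, ∑_{j=1}^{m} φ^R_{q,ν}(j|m) · (q^{j y} − 1) = ∑_{j=1}^{y} φ^R_{q,ν}(j|y) · (q^{j m} − 1). -/
/-- The finite `q`-Pochhammer symbol `(a;q)_n = ∏_{i=0}^{n−1}(1 − a q^i)`. -/
noncomputable def qPoch (a q : ℝ) (n : ℕ) : ℝ := ∏ i ∈ Finset.range n, (1 - a * q ^ i)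

/-- The right jump rates
`φ^R_{q,ν}(j|m) = R·(ν^{j−1}/[j]_q)·((ν;q)_{m−j}/(ν;q)_m)·((q;q)_m/(q;q)_{m−j})`. -/
noncomputable def phiR (q ν R : ℝ) (j m : ℕ) : ℝ :=
  R * ν ^ (j - 1) / ((1 - q ^ j) / (1 - q)) * (qPoch ν q (m - j) / qPoch ν q m) *
    (qPoch q q m / qPoch q q (m - j))

noncomputable def qa (q ν : ℝ) (n : ℕ) : ℝ := qPoch ν q n / qPoch q q n

noncomputable def Gs (q ν : ℝ) (m y : ℕ) : ℝ :=
  (∑ j ∈ Finset.range m, ν ^ j * q ^ ((j + 1) * y) * qa q ν (m - 1 - j)) / qa q ν m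

noncomputable def Fs (q ν : ℝ) (m y : ℕ) : ℝ :=
  (∑ j ∈ Finset.range m,
    ν ^ j / (1 - q ^ (j + 1)) * (1 - q ^ ((j + 1) * y)) * qa q ν (m - 1 - j)) / qa q ν m

lemma one_sub_pos (q ν : ℝ) (hq : q ∈ Set.Ioo (0 : ℝ) 1) (hν : ν ∈ Set.Ico (0 : ℝ) 1) (i : ℕ) :
    0 < 1 - ν * q ^ i := by
  have h1 : q ^ i ≤ 1 := pow_le_one₀ hq.1.le hq.2.le
  have h0 : 0 ≤ q ^ i := pow_nonneg hq.1.le i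
  nlinarith [hν.1, hν.2]

lemma qPoch_pos (q ν : ℝ) (hq : q ∈ Set.Ioo (0 : ℝ) 1) (hν : ν ∈ Set.Ico (0 : ℝ) 1) (n : ℕ) :
    0 < qPoch ν q n :=
  Finset.prod_pos fun i _ => one_sub_pos q ν hq hν i

lemma Gs_zero (q ν : ℝ) (y : ℕ) : Gs q ν 0 y = 0 := by simp [Gs]

lemma Gs_rec (q ν : ℝ) (hq : q ∈ Set.Ioo (0 : ℝ) 1) (hν : ν ∈ Set.Ico (0 : ℝ) 1) (m y : ℕ) :
    (1 - ν * q ^ m) * Gs q ν (m + 1) y = (1 - q ^ (m + 1)) * q ^ y * (1 + ν * Gs q ν m y) := by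
  have hq' : q ∈ Set.Ico (0 : ℝ) 1 := ⟨hq.1.le, hq.2⟩
  have p1 := (qPoch_pos q ν hq hν m).ne'
  have p2 := (qPoch_pos q q hq hq' m).ne'
  have p3 := (one_sub_pos q ν hq hν m).ne'
  have p4 := (one_sub_pos q q hq hq' m).ne'
  have ha : qa q ν m ≠ 0 := div_ne_zero p1 p2
  have hs : qa q ν (m + 1) = qa q ν m * ((1 - ν * q ^ m) / (1 - q * q ^ m)) := by
    simp only [qa, qPoch, Finset.prod_range_succ]
    rw [mul_div_mul_comm]
  have hsum : (∑ j ∈ Finset.range (m + 1), ν ^ j * q ^ ((j + 1) * y) * qa q ν (m + 1 - 1 - j))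
      = ν * q ^ y * (∑ j ∈ Finset.range m, ν ^ j * q ^ ((j + 1) * y) * qa q ν (m - 1 - j))
        + q ^ y * qa q ν m := by
    rw [Finset.sum_range_succ', Finset.mul_sum]
    congr 1
    · apply Finset.sum_congr rfl
      intro j _
      have : m + 1 - 1 - (j + 1) = m - 1 - j := by omega
      rw [this]; ring
    · simp
  unfold Gs
  rw [hsum, hs]
  field_simp
  ring

lemma Gs_yrec (q ν : ℝ) (hq : q ∈ Set.Ioo (0 : ℝ) 1) (hν : ν ∈ Set.Ico (0 : ℝ) 1) (m y : ℕ) :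
    (1 - ν * q ^ (y + 1)) * Gs q ν m (y + 1)
      = q ^ (y + 1) - q ^ m + q ^ m * (1 - q ^ (y + 1)) * (1 + ν * Gs q ν m y) := by
  induction m with
  | zero => simp [Gs_zero]
  | succ m ih =>
    have r1 := Gs_rec q ν hq hν m (y + 1)
    have r2 := Gs_rec q ν hq hν m y
    apply mul_left_cancel₀ (one_sub_pos q ν hq hν m).ne'
    linear_combination (1 - ν * q ^ (y + 1)) * r1
      + (1 - q ^ (m + 1)) * q ^ (y + 1) * ν * ih - q ^ (m + 1) * (1 - q ^ (y + 1)) * ν * r2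

lemma Gs_y0 (q ν : ℝ) (hq : q ∈ Set.Ioo (0 : ℝ) 1) (hν : ν ∈ Set.Ico (0 : ℝ) 1) (m : ℕ) :
    (1 - ν) * Gs q ν m 0 = 1 - q ^ m := by
  induction m with
  | zero => simp [Gs_zero]
  | succ m ih =>
    have r1 := Gs_rec q ν hq hν m 0
    apply mul_left_cancel₀ (one_sub_pos q ν hq hν m).ne'
    linear_combination (1 - ν) * r1 + (1 - q ^ (m + 1)) * ν * ih

lemma Gs_swap (q ν : ℝ) (hq : q ∈ Set.Ioo (0 : ℝ) 1) (hν : ν ∈ Set.Ico (0 : ℝ) 1) (m y : ℕ) :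
    (1 - ν * q ^ y) * Gs q ν m y - q ^ y = (1 - ν * q ^ m) * Gs q ν y m - q ^ m := by
  induction y with
  | zero =>
    have := Gs_y0 q ν hq hν m
    rw [Gs_zero]
    linear_combination this
  | succ y ih =>
    have r1 := Gs_yrec q ν hq hν m y
    have r2 := Gs_rec q ν hq hν y m
    apply mul_left_cancel₀ (one_sub_pos q ν hq hν y).ne'
    linear_combination (1 - ν * q ^ y) * r1 - (1 - ν * q ^ m) * r2
      + ν * q ^ m * (1 - q ^ (y + 1)) * ih

lemma Gs_diff (q ν : ℝ) (hq : q ∈ Set.Ioo (0 : ℝ) 1) (hν : ν ∈ Set.Ico (0 : ℝ) 1) (m y : ℕ) :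
    Gs q ν (m + 1) y - Gs q ν m y = Gs q ν (y + 1) m - Gs q ν y m := by
  have r1 := Gs_rec q ν hq hν m y
  have r2 := Gs_rec q ν hq hν y m
  have r3 := Gs_swap q ν hq hν m y
  apply mul_left_cancel₀ (one_sub_pos q ν hq hν m).ne'
  apply mul_left_cancel₀ (one_sub_pos q ν hq hν y).ne'
  linear_combination (1 - ν * q ^ y) * r1 - (1 - ν * q ^ m) * r2
    + (ν * q ^ y - ν * q ^ (y + m + 1) - 1 + ν * q ^ m) * r3

lemma Fs_diff (q ν : ℝ) (hq : q ∈ Set.Ioo (0 : ℝ) 1) (m y : ℕ) :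
    Fs q ν m (y + 1) = Fs q ν m y + Gs q ν m y := by
  unfold Fs Gs
  rw [← add_div, ← Finset.sum_add_distrib]
  congr 1
  apply Finset.sum_congr rfl
  intro j _
  have : 1 - q ^ (j + 1) ≠ 0 := by
    have := pow_lt_one₀ hq.1.le hq.2 (Nat.succ_ne_zero j)
    exact (sub_pos.mpr this).ne'
  have e : q ^ ((j + 1) * (y + 1)) = q ^ ((j + 1) * y) * q ^ (j + 1) := by ring
  rw [e]
  generalize q ^ ((j + 1) * y) = A at *
  generalize q ^ (j + 1) = B at *
  field_simp
  ring

lemma Fs_symm (q ν : ℝ) (hq : q ∈ Set.Ioo (0 : ℝ) 1) (hν : ν ∈ Set.Ico (0 : ℝ) 1) (m y : ℕ) :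
    Fs q ν m y = Fs q ν y m := by
  induction m generalizing y with
  | zero => simp [Fs]
  | succ m ih =>
    induction y with
    | zero => simp [Fs]
    | succ y ihy =>
      have h1 := Fs_diff q ν hq (m + 1) y
      have h2 := Fs_diff q ν hq (y + 1) m
      have h3 := Fs_diff q ν hq m y
      have h4 := Fs_diff q ν hq y m
      linarith [ih y, ih (y + 1), Gs_diff q ν hq hν m y]

lemma phiR_sum (q ν R : ℝ) (m y : ℕ) :
    ∑ j ∈ Finset.Icc 1 m, phiR q ν R j m * (q ^ (j * y) - 1)
      = -(R * (1 - q)) * Fs q ν m y := by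
  have : Finset.Icc 1 m = Finset.Ico 1 (m + 1) := by ext; simp [Nat.lt_succ_iff]
  rw [this, Finset.sum_Ico_eq_sum_range, Fs, ← mul_div_assoc, Finset.mul_sum, Finset.sum_div]
  apply Finset.sum_congr rfl
  intro j _
  have e : m - 1 - j = m - (j + 1) := by omega
  rw [e, add_comm 1 j]
  simp only [phiR, qa, Nat.add_sub_cancel, div_eq_mul_inv, mul_inv, inv_inv]
  ring

/-- for `q ∈ (0,1)`, `ν ∈ [0,1)`, `R ≥ 0` and positive integers `m, y`,
`∑_{j=1}^{m} φ^R_{q,ν}(j|m)·(q^{j y} − 1) = ∑_{j=1}^{y} φ^R_{q,ν}(j|y)·(q^{j m} − 1)`. -/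
theorem phiR_symmetry (q ν R : ℝ) (hq : q ∈ Set.Ioo (0 : ℝ) 1) (hν : ν ∈ Set.Ico (0 : ℝ) 1)
    (hR : 0 ≤ R) (m y : ℕ) (hm : 0 < m) (hy : 0 < y) :
    ∑ j ∈ Finset.Icc 1 m, phiR q ν R j m * (q ^ (j * y) - 1)
      = ∑ j ∈ Finset.Icc 1 y, phiR q ν R j y * (q ^ (j * m) - 1) := by
  rw [phiR_sum, phiR_sum, Fs_symm q ν hq hν m y]
end

section
/- Fix q ∈ (0,1), ν ∈ [0,1) and L ≥ 0. For all positive integers m and y, ∑_{j=1}^{m} φ^L_{q,ν}(j|m) · (q^{−j y} − 1) = ∑_{j=1}^{y} φ^L_{q,ν}(j|y) · (q^{−j m} − 1). -/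
/-- The left jump rates
`φ^L_{q,ν}(j|m) = L·(1/[j]_q)·((ν;q)_{m−j}/(ν;q)_m)·((q;q)_m/(q;q)_{m−j})`. -/
noncomputable def phiL (q ν L : ℝ) (j m : ℕ) : ℝ :=
  L / ((1 - q ^ j) / (1 - q)) * (qPoch ν q (m - j) / qPoch ν q m) *
    (qPoch q q m / qPoch q q (m - j))

/-- Partial sums `∑ r_m r_{m-1} ⋯ x^k`, defined through their recursion. -/
noncomputable def bAux (q ν x : ℝ) : ℕ → ℝ
  | 0 => 1
  | m + 1 => 1 + (1 - q * q ^ m) / (1 - ν * q ^ m) * x * bAux q ν x m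

theorem one_sub_nu_pos {q ν : ℝ} (hq : q ∈ Set.Ioo (0 : ℝ) 1) (hν : ν ∈ Set.Ico (0 : ℝ) 1)
    (m : ℕ) : 0 < 1 - ν * q ^ m := by
  have h1 : q ^ m ≤ 1 := pow_le_one₀ hq.1.le hq.2.le
  have h2 : 0 < q ^ m := pow_pos hq.1 m
  have := hν.1
  have := hν.2
  nlinarith

theorem one_sub_q_pos {q : ℝ} (hq : q ∈ Set.Ioo (0 : ℝ) 1) (m : ℕ) : 0 < 1 - q * q ^ m := by
  have h1 : q ^ m ≤ 1 := pow_le_one₀ hq.1.le hq.2.le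
  have h2 : 0 < q ^ m := pow_pos hq.1 m
  have := hq.1
  have := hq.2
  nlinarith

theorem qPoch_succ (a q : ℝ) (n : ℕ) : qPoch a q (n + 1) = qPoch a q n * (1 - a * q ^ n) := by
  simp [qPoch, Finset.prod_range_succ]

theorem qPoch_nu_ne {q ν : ℝ} (hq : q ∈ Set.Ioo (0 : ℝ) 1) (hν : ν ∈ Set.Ico (0 : ℝ) 1)
    (m : ℕ) : qPoch ν q m ≠ 0 :=
  Finset.prod_ne_zero_iff.2 fun i _ => (one_sub_nu_pos hq hν i).ne'

theorem qPoch_q_ne {q : ℝ} (hq : q ∈ Set.Ioo (0 : ℝ) 1) (m : ℕ) : qPoch q q m ≠ 0 :=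
  Finset.prod_ne_zero_iff.2 fun i _ => (one_sub_q_pos hq i).ne'

/-- The weights without the factor `1 / [j]_q`. -/
noncomputable def pAux (q ν : ℝ) (j m : ℕ) : ℝ :=
  (qPoch ν q (m - j) / qPoch ν q m) * (qPoch q q m / qPoch q q (m - j))

theorem pAux_succ {q ν : ℝ} (j m : ℕ) :
    pAux q ν (j + 1) (m + 1) = (1 - q * q ^ m) / (1 - ν * q ^ m) * pAux q ν j m := by
  unfold pAux
  rw [Nat.add_sub_add_right, qPoch_succ, qPoch_succ]
  simp only [div_eq_mul_inv, mul_inv]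
  ring

theorem bAux_eq_sum {q ν : ℝ} (hq : q ∈ Set.Ioo (0 : ℝ) 1) (hν : ν ∈ Set.Ico (0 : ℝ) 1)
    (x : ℝ) (m : ℕ) :
    ∑ i ∈ Finset.range m, pAux q ν (i + 1) m * x ^ (i + 1) = bAux q ν x m - 1 := by
  induction m with
  | zero => simp [bAux]
  | succ m ih =>
    have h0 : pAux q ν 0 m = 1 := by
      have := qPoch_nu_ne hq hν m
      have := qPoch_q_ne hq m
      simp only [pAux, Nat.sub_zero]
      field_simp
    have h : ∑ i ∈ Finset.range (m + 1), pAux q ν i m * x ^ i = bAux q ν x m := by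
      rw [Finset.sum_range_succ', ih, h0]
      ring
    rw [bAux, ← h, Finset.mul_sum, add_sub_cancel_left]
    refine Finset.sum_congr rfl fun i _ => ?_
    rw [pAux_succ]
    ring

/-- Contiguous relation. -/
theorem bAux_contig {q ν : ℝ} (hq : q ∈ Set.Ioo (0 : ℝ) 1) (hν : ν ∈ Set.Ico (0 : ℝ) 1)
    (x : ℝ) (m : ℕ) :
    (1 - x) * bAux q ν x m = 1 - ν * q ^ m + q ^ m * (ν - x) * bAux q ν (x / q) m := by
  have hq0 := hq.1.ne'
  induction m with
  | zero => simp [bAux]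
  | succ m ih =>
    have h1 := (one_sub_nu_pos hq hν m).ne'
    set r := (1 - q * q ^ m) / (1 - ν * q ^ m) with hr
    have hr' : r * (1 - ν * q ^ m) = 1 - q * q ^ m := by rw [hr]; exact div_mul_cancel₀ _ h1
    have hxq : x / q * q = x := by field_simp
    simp only [bAux, ← hr]
    rw [pow_succ]
    linear_combination r * x * ih + x * hr' -
      q ^ m * (ν - x) * r * bAux q ν (x / q) m * hxq

theorem bAux_symm {q ν : ℝ} (hq : q ∈ Set.Ioo (0 : ℝ) 1) (hν : ν ∈ Set.Ico (0 : ℝ) 1)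
    (m n : ℕ) :
    bAux q ν (1 / q ^ (n + 1)) m * q ^ m * (1 - ν * q ^ n)
      = bAux q ν (1 / q ^ (m + 1)) n * q ^ n * (1 - ν * q ^ m) := by
  have hq0 := hq.1.ne'
  induction m with
  | zero =>
    have := bAux_contig hq hν 1 n
    simp only [bAux, zero_add, pow_one, pow_zero]
    linear_combination -this
  | succ m ih =>
    have h2 := bAux_contig hq hν (1 / q ^ (m + 1)) n
    have e : 1 / q ^ (m + 1) / q = 1 / q ^ (m + 1 + 1) := by
      rw [pow_succ q (m + 1)]; field_simp
    rw [e] at h2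
    have h1 := (one_sub_nu_pos hq hν m).ne'
    have hm : q ^ m ≠ 0 := pow_ne_zero _ hq0
    have hn : q ^ n ≠ 0 := pow_ne_zero _ hq0
    simp only [bAux]
    generalize bAux q ν (1 / q ^ (m + 1 + 1)) n = C at *
    generalize bAux q ν (1 / q ^ (m + 1)) n = B at *
    generalize bAux q ν (1 / q ^ (n + 1)) m = A at *
    simp only [pow_succ] at *
    generalize q ^ m = u at *
    generalize q ^ n = v at *
    have h3 : (u * q - 1) * B = u * q * (1 - ν * v) + v * (ν * u * q - 1) * C := by
      field_simp at h2
      linear_combination h2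
    have h4 : (1 + (1 - q * u) / (1 - ν * u) * (1 / (v * q)) * A) * (u * q) * (1 - ν * v)
        = u * q * (1 - ν * v) + (1 - q * u) * B := by
      generalize hs : 1 - ν * u = s at *
      field_simp
      linear_combination (1 - q * u) * ih
    rw [h4]
    linear_combination -h3

/-- Symmetry of the mixed second difference. -/
theorem diff_symm {q ν : ℝ} (hq : q ∈ Set.Ioo (0 : ℝ) 1) (hν : ν ∈ Set.Ico (0 : ℝ) 1)
    (m n : ℕ) :
    bAux q ν (1 / q ^ (n + 1)) (m + 1) - bAux q ν (1 / q ^ (n + 1)) m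
      = bAux q ν (1 / q ^ (m + 1)) (n + 1) - bAux q ν (1 / q ^ (m + 1)) n := by
  have hq0 := hq.1.ne'
  have h := bAux_symm hq hν m n
  have h1 := (one_sub_nu_pos hq hν m).ne'
  have h2 := (one_sub_nu_pos hq hν n).ne'
  have hm : q ^ m ≠ 0 := pow_ne_zero _ hq0
  have hn : q ^ n ≠ 0 := pow_ne_zero _ hq0
  simp only [bAux]
  generalize bAux q ν (1 / q ^ (m + 1)) n = B at *
  generalize bAux q ν (1 / q ^ (n + 1)) m = A at *
  simp only [pow_succ] at *
  generalize q ^ m = u at *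
  generalize q ^ n = v at *
  have hA : A = B * v * (1 - ν * u) / (u * (1 - ν * v)) := by
    rw [eq_div_iff (mul_ne_zero hm h2)]
    linear_combination h
  rw [hA]
  generalize hs : 1 - ν * u = s at *
  generalize ht : 1 - ν * v = t at *
  field_simp
  rw [← hs, ← ht]
  ring

/-- The normalised sum. -/
noncomputable def uAux (q ν : ℝ) (m y : ℕ) : ℝ :=
  ∑ i ∈ Finset.range m, pAux q ν (i + 1) m / (1 - q ^ (i + 1)) * ((1 / q ^ y) ^ (i + 1) - 1)

theorem uAux_diff {q ν : ℝ} (hq : q ∈ Set.Ioo (0 : ℝ) 1) (hν : ν ∈ Set.Ico (0 : ℝ) 1)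
    (m y : ℕ) :
    uAux q ν m (y + 1) - uAux q ν m y = bAux q ν (1 / q ^ (y + 1)) m - 1 := by
  rw [← bAux_eq_sum hq hν, uAux, uAux, ← Finset.sum_sub_distrib]
  refine Finset.sum_congr rfl fun i _ => ?_
  have h : 1 - q ^ (i + 1) ≠ 0 := by
    rw [pow_succ']; exact (one_sub_q_pos hq i).ne'
  have e : (1 / q ^ y) ^ (i + 1) = (1 / q ^ (y + 1)) ^ (i + 1) * q ^ (i + 1) := by
    rw [← mul_pow]
    congr 1
    have := hq.1.ne'
    rw [pow_succ]; field_simp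
  rw [e]
  field_simp
  ring

theorem uAux_symm {q ν : ℝ} (hq : q ∈ Set.Ioo (0 : ℝ) 1) (hν : ν ∈ Set.Ico (0 : ℝ) 1)
    (m : ℕ) : ∀ y : ℕ, uAux q ν m y = uAux q ν y m := by
  induction m with
  | zero => intro y; simp [uAux]
  | succ m ih =>
    intro y
    induction y with
    | zero => simp [uAux]
    | succ y ihy =>
      have a1 := uAux_diff hq hν (m + 1) y
      have a2 := uAux_diff hq hν m y
      have a3 := uAux_diff hq hν (y + 1) m
      have a4 := uAux_diff hq hν y m
      have d := diff_symm hq hν m y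
      have i1 := ih (y + 1)
      have i2 := ih y
      linarith

theorem sum_eq_uAux (q ν L : ℝ) (m y : ℕ) :
    ∑ j ∈ Finset.Icc 1 m, phiL q ν L j m * (q ^ (-(j * y : ℤ)) - 1)
      = L * (1 - q) * uAux q ν m y := by
  rw [uAux, Finset.mul_sum, ← Finset.Ico_add_one_right_eq_Icc, Finset.sum_Ico_eq_sum_range,
    Nat.add_sub_cancel]
  refine Finset.sum_congr rfl fun i _ => ?_
  rw [add_comm 1 i]
  have e : q ^ (-(((i + 1 : ℕ) : ℤ) * (y : ℤ))) = (1 / q ^ y) ^ (i + 1) := by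
    rw [zpow_neg, one_div, inv_pow, ← pow_mul, mul_comm y, ← Nat.cast_mul, zpow_natCast]
  rw [e, phiL, pAux]
  simp only [div_eq_mul_inv, mul_inv, inv_inv]
  ring

/-- for `q ∈ (0,1)`, `ν ∈ [0,1)`, `L ≥ 0` and positive integers `m, y`,
`∑_{j=1}^{m} φ^L_{q,ν}(j|m)·(q^{−j y} − 1) = ∑_{j=1}^{y} φ^L_{q,ν}(j|y)·(q^{−j m} − 1)`. -/
theorem phiL_symmetry (q ν L : ℝ) (hq : q ∈ Set.Ioo (0 : ℝ) 1) (hν : ν ∈ Set.Ico (0 : ℝ) 1)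
    (hL : 0 ≤ L) (m y : ℕ) (hm : 0 < m) (hy : 0 < y) :
    ∑ j ∈ Finset.Icc 1 m, phiL q ν L j m * (q ^ (-(j * y : ℤ)) - 1)
      = ∑ j ∈ Finset.Icc 1 y, phiL q ν L j y * (q ^ (-(j * m : ℤ)) - 1) := by
  rw [sum_eq_uAux, sum_eq_uAux, uAux_symm hq hν]
end

section
/- Fix q ∈ (0,1), ν ∈ (0,1) and integers 1 ≤ j ≤ m, and for ε > 0 set μ(ε) = ν + (1−q)ε. Then as ε → 0⁺: (i) φ_{q, μ(ε), ν}(j|m)/ε converges to (ν^{j−1}/[j]_q)·((ν;q)_{m−j}/(ν;q)_m)·((q;q)_m/(q;q)_{m−j}); and (ii) φ_{q^{−1}, μ(ε)^{−1}, ν^{−1}}(j|m)/ε converges to (ν^{−1}/[j]_q)·((ν;q)_{m−j}/(ν;q)_m)·((q;q)_m/(q;q)_{m−j}). -/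
open Filter

/-- The `q`-Hahn weight
`φ_{q,μ,ν}(j|m) = μ^j·((ν/μ;q)_j·(μ;q)_{m−j}/(ν;q)_m)·((q;q)_m/((q;q)_j·(q;q)_{m−j}))`. -/
noncomputable def qHahnW (q μ ν : ℝ) (j m : ℕ) : ℝ :=
  μ ^ j * (qPoch (ν / μ) q j * qPoch μ q (m - j) / qPoch ν q m) *
    (qPoch q q m / (qPoch q q j * qPoch q q (m - j)))

theorem qPoch_shift (a q : ℝ) (k : ℕ) : qPoch a q (k + 1) = (1 - a) * qPoch (a * q) q k := by
  unfold qPoch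
  rw [Finset.prod_range_succ', mul_comm]
  simp [pow_succ', mul_assoc]

theorem qPoch_last (a q : ℝ) (k : ℕ) : qPoch a q (k + 1) = qPoch a q k * (1 - a * q ^ k) := by
  unfold qPoch
  rw [Finset.prod_range_succ]

theorem qPoch_cont (q : ℝ) (n : ℕ) : Continuous (fun a : ℝ => qPoch a q n) := by
  unfold qPoch
  fun_prop

theorem qPoch_inv (a q : ℝ) (ha : a ≠ 0) (hq : q ≠ 0) (n : ℕ) :
    qPoch a⁻¹ q⁻¹ n =
      qPoch a q n * ((-1) ^ n * (a⁻¹) ^ n * ∏ i ∈ Finset.range n, (q⁻¹) ^ i) := by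
  induction n with
  | zero => simp [qPoch]
  | succ n ih =>
    rw [qPoch_last, qPoch_last, ih, Finset.prod_range_succ]
    have h : 1 - a⁻¹ * q⁻¹ ^ n = (1 - a * q ^ n) * (-1 * a⁻¹ * q⁻¹ ^ n) := by
      rw [inv_pow]
      field_simp
      ring
    rw [h]
    ring

theorem qPoch_ne (a q : ℝ) (ha : a ∈ Set.Ioo (0 : ℝ) 1) (hq : q ∈ Set.Ioo (0 : ℝ) 1) (n : ℕ) :
    qPoch a q n ≠ 0 := by
  unfold qPoch
  refine Finset.prod_ne_zero_iff.mpr fun i _ => ?_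
  have h1 : q ^ i ≤ 1 := pow_le_one₀ hq.1.le hq.2.le
  have h2 := hq.1
  have h3 : a * q ^ i ≤ a * 1 := mul_le_mul_of_nonneg_left h1 ha.1.le
  have h4 := ha.2
  intro h
  linarith

theorem qHahn_general (Q ν c : ℝ) (μ : ℝ → ℝ) (l : Filter ℝ) (k n : ℕ) (hν : ν ≠ 0)
    (hQ : qPoch Q Q (k + 1) ≠ 0) (hμ : Tendsto μ l (nhds ν))
    (hc : Tendsto (fun ε => (1 - ν / μ ε) / ε) l (nhds c)) :
    Tendsto (fun ε => qHahnW Q (μ ε) ν (k + 1) (n + (k + 1)) / ε) l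
      (nhds (ν ^ (k + 1) * (c / (1 - Q ^ (k + 1))) * (qPoch ν Q n / qPoch ν Q (n + (k + 1))) *
        (qPoch Q Q (n + (k + 1)) / qPoch Q Q n))) := by
  have h1 : Tendsto (fun ε => ν / μ ε * Q) l (nhds (ν / ν * Q)) :=
    (tendsto_const_nhds.div hμ hν).mul_const Q
  have h2 := ((qPoch_cont Q k).tendsto _).comp h1
  have h3 := ((qPoch_cont Q n).tendsto _).comp hμ
  have h4 := ((((hμ.pow (k + 1)).mul ((hc.mul h2).mul h3)).div_const
    (qPoch ν Q (n + (k + 1)))).mul_const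
      (qPoch Q Q (n + (k + 1)) / (qPoch Q Q (k + 1) * qPoch Q Q n)))
  rw [div_self hν, one_mul] at h4
  rw [qPoch_last] at hQ h4
  have h5 := left_ne_zero_of_mul hQ
  convert h4 using 1
  · funext ε
    simp only [qHahnW, Nat.add_sub_cancel, Function.comp]
    rw [qPoch_shift (ν / μ ε), qPoch_last Q Q k]
    ring
  · congr 1
    rw [← pow_succ']
    have : qPoch Q Q k * (qPoch Q Q k)⁻¹ = 1 := mul_inv_cancel₀ h5
    simp only [div_eq_mul_inv, mul_inv]
    linear_combination (-(ν ^ (k + 1) * c * (1 - Q ^ (k + 1))⁻¹ * qPoch ν Q n *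
      (qPoch ν Q (n + (k + 1)))⁻¹ * qPoch Q Q (n + (k + 1)) * (qPoch Q Q n)⁻¹)) * this

/-- fix `q ∈ (0,1)`, `ν ∈ (0,1)`, `1 ≤ j ≤ m`, and set `μ(ε) = ν + (1−q)ε`.
As `ε → 0⁺`:
(i) `φ_{q,μ(ε),ν}(j|m)/ε → (ν^{j−1}/[j]_q)·((ν;q)_{m−j}/(ν;q)_m)·((q;q)_m/(q;q)_{m−j})`;
(ii) `φ_{q⁻¹,μ(ε)⁻¹,ν⁻¹}(j|m)/ε → (ν⁻¹/[j]_q)·((ν;q)_{m−j}/(ν;q)_m)·((q;q)_m/(q;q)_{m−j})`. -/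
theorem qHahn_weights_continuous_time_limit (q ν : ℝ) (hq : q ∈ Set.Ioo (0 : ℝ) 1)
    (hν : ν ∈ Set.Ioo (0 : ℝ) 1) (j m : ℕ) (hj : 1 ≤ j) (hjm : j ≤ m) :
    Tendsto (fun ε : ℝ => qHahnW q (ν + (1 - q) * ε) ν j m / ε)
      (nhdsWithin 0 (Set.Ioi 0))
      (nhds (ν ^ (j - 1) / ((1 - q ^ j) / (1 - q)) * (qPoch ν q (m - j) / qPoch ν q m) *
        (qPoch q q m / qPoch q q (m - j)))) ∧
    Tendsto (fun ε : ℝ => qHahnW q⁻¹ (ν + (1 - q) * ε)⁻¹ ν⁻¹ j m / ε)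
      (nhdsWithin 0 (Set.Ioi 0))
      (nhds (ν⁻¹ / ((1 - q ^ j) / (1 - q)) * (qPoch ν q (m - j) / qPoch ν q m) *
        (qPoch q q m / qPoch q q (m - j)))) := by
  obtain ⟨k, rfl⟩ : ∃ k, j = k + 1 := ⟨j - 1, by omega⟩
  obtain ⟨n, rfl⟩ : ∃ n, m = n + (k + 1) := ⟨m - (k + 1), by omega⟩
  simp only [Nat.add_sub_cancel]
  have hq0 : q ≠ 0 := hq.1.ne'
  have hν0 : ν ≠ 0 := hν.1.ne'
  have hP := qPoch_ne q q hq hq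
  have hV := qPoch_ne ν q hν hq
  have hT : ∀ r, (∏ i ∈ Finset.range r, (q⁻¹) ^ i) ≠ 0 := fun r =>
    Finset.prod_ne_zero_iff.mpr fun i _ => pow_ne_zero _ (inv_ne_zero hq0)
  have hμ : Tendsto (fun ε : ℝ => ν + (1 - q) * ε) (nhdsWithin 0 (Set.Ioi 0)) (nhds ν) := by
    have h : Continuous (fun ε : ℝ => ν + (1 - q) * ε) := by fun_prop
    have h' := (h.tendsto 0).mono_left (nhdsWithin_le_nhds (s := Set.Ioi 0))
    simpa using h'
  have hqk : 1 - q ^ (k + 1) ≠ 0 := by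
    have := pow_lt_one₀ hq.1.le hq.2 (Nat.succ_ne_zero k)
    exact (sub_pos.mpr this).ne'
  have hq1 : 1 - q ≠ 0 := (sub_pos.mpr hq.2).ne'
  constructor
  · have hc : Tendsto (fun ε : ℝ => (1 - ν / (ν + (1 - q) * ε)) / ε)
        (nhdsWithin 0 (Set.Ioi 0)) (nhds ((1 - q) / ν)) := by
      refine ((tendsto_const_nhds (x := 1 - q)).div hμ hν0).congr' ?_
      filter_upwards [self_mem_nhdsWithin] with ε hε
      have hε' : (0 : ℝ) < ε := hε
      have : ν + (1 - q) * ε ≠ 0 :=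
        (add_pos hν.1 (mul_pos (sub_pos.mpr hq.2) hε')).ne'
      have h2 := hε'.ne'
      simp only [Pi.div_apply]
      field_simp
      ring
    convert qHahn_general q ν _ _ _ k n hν0 (hP _) hμ hc using 2
    congr 2
    field_simp
    ring
  · have hc : Tendsto (fun ε : ℝ => (1 - ν⁻¹ / (ν + (1 - q) * ε)⁻¹) / ε)
        (nhdsWithin 0 (Set.Ioi 0)) (nhds (-(1 - q) / ν)) := by
      refine (tendsto_const_nhds (x := -(1 - q) / ν)).congr' ?_
      filter_upwards [self_mem_nhdsWithin] with ε hε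
      have h2 : ε ≠ 0 := (show (0 : ℝ) < ε from hε).ne'
      rw [div_inv_eq_mul]
      field_simp
      ring
    have hQ : qPoch q⁻¹ q⁻¹ (k + 1) ≠ 0 := by
      rw [qPoch_inv q q hq0 hq0]
      exact mul_ne_zero (hP _) (mul_ne_zero (mul_ne_zero (by simp) (by simp [hq0])) (hT _))
    convert qHahn_general q⁻¹ ν⁻¹ _ _ _ k n (inv_ne_zero hν0) hQ (hμ.inv₀ hν0) hc using 2
    rw [qPoch_inv q q hq0 hq0, qPoch_inv q q hq0 hq0, qPoch_inv ν q hν0 hq0,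
      qPoch_inv ν q hν0 hq0]
    have h6 : 1 - q⁻¹ ^ (k + 1) = -(1 - q ^ (k + 1)) * (q⁻¹) ^ (k + 1) := by
      rw [inv_pow]
      field_simp
      ring
    rw [h6]
    have a1 := hT n
    have a2 := hT (n + (k + 1))
    have a3 := hP n
    have a4 := hV (n + (k + 1))
    generalize (∏ i ∈ Finset.range n, (q⁻¹) ^ i) = T1 at *
    generalize (∏ i ∈ Finset.range (n + (k + 1)), (q⁻¹) ^ i) = T2 at *
    generalize qPoch q q n = P1 at *
    generalize qPoch ν q (n + (k + 1)) = V2 at *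
    generalize hD : 1 - q ^ (k + 1) = D at *
    generalize 1 - q = E at *
    clear hD h6
    rw [pow_add (-1 : ℝ), pow_add ν⁻¹ n, pow_add q⁻¹ n]
    generalize hs : ((-1 : ℝ)) ^ (k + 1) = S at *
    generalize hs1 : ((-1 : ℝ)) ^ n = S1 at *
    have b1 : S ≠ 0 := by rw [← hs]; simp
    have b2 : S1 ≠ 0 := by rw [← hs1]; simp
    field_simp
end

section
/- Fix q ∈ (0,1), ν ∈ [0,1) and α ∈ (0,1). Then ((α;q)_∞/(αν;q)_∞) · ∑_{m=1}^{∞} m · α^m · (ν;q)_m/(q;q)_m = ∑_{k=0}^{∞} ( α q^k/(1 − α q^k) − α ν q^k/(1 − α ν q^k) ). (This is the computation of the mean gap under the stationary measure μ_α, i.e. E[gap] = (Ψ_q(θ) − Ψ_q(θ+V))/log q with α = q^θ, ν = q^V.) -/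
/-- coefficients -/
noncomputable def cf (ν q : ℝ) (m : ℕ) : ℝ := qPoch ν q m / qPoch q q m

/-- generating function -/
noncomputable def ff (ν q x : ℝ) : ℝ := ∑' m : ℕ, cf ν q m * x ^ m

/-- weighted generating function -/
noncomputable def gg (ν q x : ℝ) : ℝ := ∑' m : ℕ, (m : ℝ) * (cf ν q m * x ^ m)

lemma qPoch_pos_s7 {a q : ℝ} (hq0 : 0 < q) (hq1 : q < 1) (ha1 : a < 1) (m : ℕ) :
    0 < qPoch a q m := by
  unfold qPoch
  apply Finset.prod_pos
  intro i _
  have h1 : q ^ i ≤ 1 := pow_le_one₀ hq0.le hq1.le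
  have h0 : 0 < q ^ i := pow_pos hq0 i
  nlinarith

lemma cf_pos {ν q : ℝ} (hq0 : 0 < q) (hq1 : q < 1) (hν1 : ν < 1) (m : ℕ) : 0 < cf ν q m :=
  div_pos (qPoch_pos_s7 hq0 hq1 hν1 m) (qPoch_pos_s7 hq0 hq1 hq1 m)

lemma cf_succ {ν q : ℝ} (hq0 : 0 < q) (hq1 : q < 1) (m : ℕ) :
    cf ν q (m + 1) * (1 - q ^ (m + 1)) = cf ν q m * (1 - ν * q ^ m) := by
  have h := qPoch_pos_s7 hq0 hq1 hq1 m
  have h1 : q ^ (m + 1) < 1 := pow_lt_one₀ hq0.le hq1 (by simp)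
  have e1 : qPoch q q (m + 1) = qPoch q q m * (1 - q ^ (m + 1)) := by
    unfold qPoch; rw [Finset.prod_range_succ]; ring
  have e2 : qPoch ν q (m + 1) = qPoch ν q m * (1 - ν * q ^ m) := by
    unfold qPoch; rw [Finset.prod_range_succ]
  unfold cf
  rw [e1, e2]
  have h2 : 1 - q ^ (m + 1) ≠ 0 := by linarith
  field_simp

lemma summ {ν q x : ℝ} (hq0 : 0 < q) (hq1 : q < 1) (hν1 : ν < 1) (hx0 : 0 < x) (hx1 : x < 1) :
    Summable (fun m : ℕ => ((m : ℝ) + 1) * (cf ν q m * x ^ m)) := by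
  have hp : ∀ m : ℕ, 0 < ((m : ℝ) + 1) * (cf ν q m * x ^ m) := fun m => by
    have := cf_pos hq0 hq1 hν1 m
    positivity
  refine summable_of_ratio_test_tendsto_lt_one hx1
    (Filter.Eventually.of_forall fun m => (hp m).ne') ?_
  have hq : Filter.Tendsto (fun m : ℕ => q ^ m) Filter.atTop (nhds 0) :=
    tendsto_pow_atTop_nhds_zero_of_lt_one hq0.le hq1
  have hn : Filter.Tendsto (fun m : ℕ => 1 / ((m : ℝ) + 1)) Filter.atTop (nhds 0) :=
    tendsto_one_div_add_atTop_nhds_zero_nat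
  have key : Filter.Tendsto (fun m : ℕ => (1 + 1 / ((m : ℝ) + 1)) *
      ((1 - ν * q ^ m) / (1 - q * q ^ m)) * x) Filter.atTop
      (nhds ((1 + 0) * ((1 - ν * 0) / (1 - q * 0)) * x)) := by
    refine Filter.Tendsto.mul (Filter.Tendsto.mul (hn.const_add 1) ?_) tendsto_const_nhds
    exact ((hq.const_mul ν).const_sub 1).div ((hq.const_mul q).const_sub 1) (by simp)
  have e0 : (1 + 0) * ((1 - ν * 0) / (1 - q * 0)) * x = x := by simp
  rw [e0] at key
  refine key.congr fun m => ?_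
  rw [Real.norm_of_nonneg (hp _).le, Real.norm_of_nonneg (hp _).le]
  have hc := cf_pos hq0 hq1 hν1 m
  have h1 : q ^ (m + 1) < 1 := pow_lt_one₀ hq0.le hq1 (by simp)
  have h2 : (1 - q * q ^ m) ≠ 0 := by rw [← pow_succ']; linarith
  have h3 := cf_succ (ν := ν) hq0 hq1 m
  have h4 : cf ν q (m + 1) = cf ν q m * (1 - ν * q ^ m) / (1 - q * q ^ m) := by
    rw [eq_div_iff h2, ← h3, pow_succ']
  rw [h4]
  have h5 : ((m : ℝ) + 1) ≠ 0 := by positivity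
  push_cast
  field_simp
  ring

section
variable {ν q x : ℝ} (hq0 : 0 < q) (hq1 : q < 1) (hν1 : ν < 1) (hx0 : 0 < x) (hx1 : x < 1)

lemma summf (hq0 : 0 < q) (hq1 : q < 1) (hν1 : ν < 1) (hx0 : 0 < x) (hx1 : x < 1) :
    Summable (fun m : ℕ => cf ν q m * x ^ m) := by
  refine Summable.of_nonneg_of_le (fun m => ?_) (fun m => ?_) (summ hq0 hq1 hν1 hx0 hx1)
  · have := cf_pos hq0 hq1 hν1 m
    positivity
  · have := cf_pos hq0 hq1 hν1 m
    have h : 0 < cf ν q m * x ^ m := by positivity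
    have h' : (0 : ℝ) ≤ m := by positivity
    nlinarith

lemma summg (hq0 : 0 < q) (hq1 : q < 1) (hν1 : ν < 1) (hx0 : 0 < x) (hx1 : x < 1) :
    Summable (fun m : ℕ => (m : ℝ) * (cf ν q m * x ^ m)) := by
  refine ((summ hq0 hq1 hν1 hx0 hx1).sub (summf hq0 hq1 hν1 hx0 hx1)).congr fun m => ?_
  ring

lemma ff_eq (hq0 : 0 < q) (hq1 : q < 1) (hν1 : ν < 1) (hx0 : 0 < x) (hx1 : x < 1) :
    (1 - x) * ff ν q x = (1 - ν * x) * ff ν q (q * x) := by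
  have hy0 : 0 < q * x := by positivity
  have hy1 : q * x < 1 := by nlinarith
  have s1 := summf hq0 hq1 hν1 hx0 hx1
  have s2 := summf hq0 hq1 hν1 hy0 hy1
  have h : ff ν q x - ff ν q (q * x) = x * ff ν q x - ν * x * ff ν q (q * x) := by
    unfold ff
    rw [← s1.tsum_sub s2, (s1.sub s2).tsum_eq_zero_add, ← tsum_mul_left, ← tsum_mul_left,
      ← (s1.mul_left x).tsum_sub (s2.mul_left (ν * x))]
    simp only [pow_zero, sub_self, zero_add]
    refine tsum_congr fun m => ?_
    have := cf_succ (ν := ν) hq0 hq1 m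
    rw [mul_pow, mul_pow]
    linear_combination x ^ (m + 1) * this
  linarith

lemma gg_eq (hq0 : 0 < q) (hq1 : q < 1) (hν1 : ν < 1) (hx0 : 0 < x) (hx1 : x < 1) :
    gg ν q x - gg ν q (q * x) = x * (gg ν q x + ff ν q x)
      - ν * x * (gg ν q (q * x) + ff ν q (q * x)) := by
  have hy0 : 0 < q * x := by positivity
  have hy1 : q * x < 1 := by nlinarith
  have s1 := summf hq0 hq1 hν1 hx0 hx1
  have s2 := summf hq0 hq1 hν1 hy0 hy1
  have t1 := summg hq0 hq1 hν1 hx0 hx1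
  have t2 := summg hq0 hq1 hν1 hy0 hy1
  unfold ff gg
  rw [← t1.tsum_sub t2, (t1.sub t2).tsum_eq_zero_add, ← t1.tsum_add s1, ← t2.tsum_add s2,
    ← tsum_mul_left, ← tsum_mul_left,
    ← ((t1.add s1).mul_left x).tsum_sub ((t2.add s2).mul_left (ν * x))]
  simp only [Nat.cast_zero, zero_mul, sub_self, zero_add]
  refine tsum_congr fun m => ?_
  have := cf_succ (ν := ν) hq0 hq1 m
  rw [mul_pow, mul_pow]
  push_cast
  linear_combination ((m : ℝ) + 1) * x ^ (m + 1) * this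

lemma gg_nonneg (hq0 : 0 < q) (hq1 : q < 1) (hν1 : ν < 1) (hx0 : 0 < x) : 0 ≤ gg ν q x :=
  tsum_nonneg fun m => by
    have := cf_pos hq0 hq1 hν1 m
    positivity

lemma ff_bounds (hq0 : 0 < q) (hq1 : q < 1) (hν1 : ν < 1) (hx0 : 0 < x) (hx1 : x < 1) :
    1 ≤ ff ν q x ∧ ff ν q x ≤ 1 + gg ν q x := by
  have s1 := summf hq0 hq1 hν1 hx0 hx1
  have t1 := summg hq0 hq1 hν1 hx0 hx1
  have c0 : cf ν q 0 = 1 := by simp [cf, qPoch]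
  unfold ff gg
  rw [s1.tsum_eq_zero_add, t1.tsum_eq_zero_add, c0]
  simp only [pow_zero, mul_one, Nat.cast_zero, zero_add, le_add_iff_nonneg_right]
  have hp : ∀ m : ℕ, 0 ≤ cf ν q (m + 1) * x ^ (m + 1) := fun m => by
    have := cf_pos hq0 hq1 hν1 (m + 1)
    positivity
  refine ⟨tsum_nonneg hp, ?_⟩
  have := Summable.tsum_le_tsum (f := fun m : ℕ => cf ν q (m + 1) * x ^ (m + 1))
    (g := fun m : ℕ => ((m + 1 : ℕ) : ℝ) * (cf ν q (m + 1) * x ^ (m + 1))) (fun m => by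
      have h1 := hp m
      have h' : (0 : ℝ) ≤ m := by positivity
      push_cast
      nlinarith) ((summable_nat_add_iff 1).2 s1) ((summable_nat_add_iff 1).2 t1)
  linarith

lemma gg_le (hq0 : 0 < q) (hq1 : q < 1) (hν1 : ν < 1) (hx0 : 0 < x) (hx1 : x < 1) (n : ℕ) :
    gg ν q (x * q ^ n) ≤ q ^ n * gg ν q x := by
  have h0 : 0 < q ^ n := pow_pos hq0 n
  have h1 : q ^ n ≤ 1 := pow_le_one₀ hq0.le hq1.le
  have t1 := summg hq0 hq1 hν1 hx0 hx1
  have t2 := summg hq0 hq1 hν1 (x := x * q ^ n) (by positivity) (by nlinarith)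
  unfold gg
  rw [← tsum_mul_left]
  refine t2.tsum_le_tsum (fun m => ?_) (t1.mul_left _)
  rcases m with _ | m
  · simp
  · have hc := cf_pos hq0 hq1 hν1 (m + 1)
    have h2 : (q ^ n) ^ (m + 1) ≤ q ^ n := pow_le_of_le_one h0.le h1 (by simp)
    have h3 : 0 ≤ ((m + 1 : ℕ) : ℝ) * (cf ν q (m + 1) * x ^ (m + 1)) := by positivity
    rw [mul_pow]
    calc _ = ((m + 1 : ℕ) : ℝ) * (cf ν q (m + 1) * x ^ (m + 1)) * (q ^ n) ^ (m + 1) := by ring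
      _ ≤ ((m + 1 : ℕ) : ℝ) * (cf ν q (m + 1) * x ^ (m + 1)) * q ^ n := by gcongr
      _ = _ := by ring

end

lemma prodlim {a q : ℝ} (hq0 : 0 < q) (hq1 : q < 1) (ha1 : a < 1) :
    Filter.Tendsto (fun n => ∏ i ∈ Finset.range n, (1 - a * q ^ i)) Filter.atTop
      (nhds (∏' i : ℕ, (1 - a * q ^ i))) ∧ (∏' i : ℕ, (1 - a * q ^ i)) ≠ 0 := by
  have hs : Summable (fun i : ℕ => -(a * q ^ i)) :=
    ((summable_geometric_of_lt_one hq0.le hq1).mul_left a).neg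
  have hm := Real.multipliable_one_add_of_summable hs
  have hl := Real.summable_log_one_add_of_summable hs
  simp only [← sub_eq_add_neg] at hm hl
  refine ⟨hm.hasProd.tendsto_prod_nat, ?_⟩
  rw [← Real.rexp_tsum_eq_tprod (fun i => ?_) hl]
  · exact (Real.exp_pos _).ne'
  · have h1 : q ^ i ≤ 1 := pow_le_one₀ hq0.le hq1.le
    have h0 : 0 < q ^ i := pow_pos hq0 i
    nlinarith


/-- for `q ∈ (0,1)`, `ν ∈ [0,1)`, `α ∈ (0,1)`,
`((α;q)_∞/(αν;q)_∞) · ∑_{m=1}^∞ m α^m (ν;q)_m/(q;q)_m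
  = ∑_{k=0}^∞ ( αq^k/(1−αq^k) − ανq^k/(1−ανq^k) )`. -/
theorem mean_gap_stationary (q ν α : ℝ) (hq : q ∈ Set.Ioo (0 : ℝ) 1)
    (hν : ν ∈ Set.Ico (0 : ℝ) 1) (hα : α ∈ Set.Ioo (0 : ℝ) 1) :
    ((∏' i : ℕ, (1 - α * q ^ i)) / ∏' i : ℕ, (1 - α * ν * q ^ i)) *
        ∑' m : ℕ, ((m : ℝ) + 1) * α ^ (m + 1) * (qPoch ν q (m + 1) / qPoch q q (m + 1))
      = ∑' k : ℕ, (α * q ^ k / (1 - α * q ^ k) - α * ν * q ^ k / (1 - α * ν * q ^ k)) := by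
  obtain ⟨hq0, hq1⟩ := hq
  obtain ⟨hν0, hν1⟩ := hν
  obtain ⟨hα0, hα1⟩ := hα
  have hx0 : ∀ n : ℕ, 0 < α * q ^ n := fun n => by positivity
  have hx1 : ∀ n : ℕ, α * q ^ n < 1 := fun n => by
    have h1 : q ^ n ≤ 1 := pow_le_one₀ hq0.le hq1.le
    nlinarith
  have hy1 : ∀ n : ℕ, α * ν * q ^ n < 1 := fun n => by
    have h1 := hx0 n
    have h2 := hx1 n
    nlinarith
  have hstep : ∀ n : ℕ, q * (α * q ^ n) = α * q ^ (n + 1) := fun n => by ring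
  have hF := fun n => ff_bounds hq0 hq1 hν1 (hx0 n) (hx1 n)
  have hq : Filter.Tendsto (fun m : ℕ => q ^ m) Filter.atTop (nhds 0) :=
    tendsto_pow_atTop_nhds_zero_of_lt_one hq0.le hq1
  have hglim : Filter.Tendsto (fun n : ℕ => gg ν q (α * q ^ n)) Filter.atTop (nhds 0) := by
    refine squeeze_zero (fun n => gg_nonneg hq0 hq1 hν1 (hx0 n))
      (fun n => gg_le hq0 hq1 hν1 hα0 hα1 n) ?_
    simpa using hq.mul_const (gg ν q α)
  have hflim : Filter.Tendsto (fun n : ℕ => ff ν q (α * q ^ n)) Filter.atTop (nhds 1) := by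
    refine tendsto_of_tendsto_of_tendsto_of_le_of_le tendsto_const_nhds ?_
      (fun n => (hF n).1) (fun n => (hF n).2)
    simpa using hglim.const_add 1
  -- the product formula
  obtain ⟨hA, hA0⟩ := prodlim hq0 hq1 hα1
  obtain ⟨hB, hB0⟩ := prodlim (a := α * ν) hq0 hq1 (by simpa using hy1 0)
  have hprod : ∀ n : ℕ, (∏ i ∈ Finset.range n, (1 - α * q ^ i)) * ff ν q α
      = (∏ i ∈ Finset.range n, (1 - α * ν * q ^ i)) * ff ν q (α * q ^ n) := by
    intro n
    induction n with
    | zero => simp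
    | succ n ih =>
      have h := ff_eq hq0 hq1 hν1 (hx0 n) (hx1 n)
      rw [hstep] at h
      rw [Finset.prod_range_succ, Finset.prod_range_succ]
      linear_combination (1 - α * q ^ n) * ih
        + (∏ i ∈ Finset.range n, (1 - α * ν * q ^ i)) * h
  have hAB : (∏' i : ℕ, (1 - α * q ^ i)) * ff ν q α = ∏' i : ℕ, (1 - α * ν * q ^ i) := by
    refine tendsto_nhds_unique (hA.mul_const (ff ν q α)) ?_
    simp only [hprod]
    simpa using hB.mul hflim
  -- the telescoping
  have htel : ∀ n : ℕ, ∑ k ∈ Finset.range n,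
      (α * q ^ k / (1 - α * q ^ k) - α * ν * q ^ k / (1 - α * ν * q ^ k))
      = gg ν q α / ff ν q α - gg ν q (α * q ^ n) / ff ν q (α * q ^ n) := by
    intro n
    induction n with
    | zero => simp
    | succ n ih =>
      rw [Finset.sum_range_succ, ih]
      have h := ff_eq hq0 hq1 hν1 (hx0 n) (hx1 n)
      have h' := gg_eq hq0 hq1 hν1 (hx0 n) (hx1 n)
      rw [hstep] at h h'
      have p1 : ff ν q (α * q ^ n) ≠ 0 := by linarith [(hF n).1]
      have p2 : ff ν q (α * q ^ (n + 1)) ≠ 0 := by linarith [(hF (n + 1)).1]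
      have p3 : 1 - α * q ^ n ≠ 0 := by linarith [hx1 n]
      have p4 : 1 - α * ν * q ^ n ≠ 0 := by linarith [hy1 n]
      have e1 : gg ν q (α * q ^ n) / ff ν q (α * q ^ n) - α * q ^ n / (1 - α * q ^ n)
          = ((1 - α * q ^ n) * gg ν q (α * q ^ n) - α * q ^ n * ff ν q (α * q ^ n)) /
            ((1 - α * q ^ n) * ff ν q (α * q ^ n)) := by
        field_simp
      have e2 : gg ν q (α * q ^ (n + 1)) / ff ν q (α * q ^ (n + 1))
            - α * ν * q ^ n / (1 - α * ν * q ^ n)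
          = ((1 - α * ν * q ^ n) * gg ν q (α * q ^ (n + 1))
              - α * ν * q ^ n * ff ν q (α * q ^ (n + 1))) /
            ((1 - α * ν * q ^ n) * ff ν q (α * q ^ (n + 1))) := by
        field_simp
      have e3 : (1 - α * q ^ n) * gg ν q (α * q ^ n) - α * q ^ n * ff ν q (α * q ^ n)
          = (1 - α * ν * q ^ n) * gg ν q (α * q ^ (n + 1))
              - α * ν * q ^ n * ff ν q (α * q ^ (n + 1)) := by
        linear_combination h'
      have e4 : (1 - α * q ^ n) * ff ν q (α * q ^ n)
          = (1 - α * ν * q ^ n) * ff ν q (α * q ^ (n + 1)) := by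
        linear_combination h
      rw [e3, e4, ← e2] at e1
      linarith
  have hsum : HasSum (fun k : ℕ =>
      α * q ^ k / (1 - α * q ^ k) - α * ν * q ^ k / (1 - α * ν * q ^ k))
      (gg ν q α / ff ν q α) := by
    rw [hasSum_iff_tendsto_nat_of_nonneg]
    · simp only [htel]
      simpa using (hglim.div hflim one_ne_zero).const_sub (gg ν q α / ff ν q α)
    · intro k
      have h1 := hx0 k
      have h2 := hx1 k
      have h3 : α * ν * q ^ k ≤ α * q ^ k := by nlinarith
      rw [sub_nonneg]
      apply div_le_div₀ h1.le h3 (by linarith) (by linarith)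
  have hG : ∑' m : ℕ, ((m : ℝ) + 1) * α ^ (m + 1) * (qPoch ν q (m + 1) / qPoch q q (m + 1))
      = gg ν q α := by
    unfold gg
    rw [(summg hq0 hq1 hν1 hα0 hα1).tsum_eq_zero_add]
    simp only [Nat.cast_zero, zero_mul, zero_add]
    refine tsum_congr fun m => ?_
    unfold cf
    push_cast
    ring
  rw [hsum.tsum_eq, hG, ← hAB]
  have p1 : ff ν q α ≠ 0 := by
    have := (ff_bounds hq0 hq1 hν1 hα0 hα1).1
    linarith
  field_simp
end

section
/- Fix α ∈ (0,1) and u ∈ (0,π), and set w = α·e^{iu} ∈ ℂ. Then Im[ (w/(1−w))·( 1 − α² − (1−α)²/(1−w) ) ] = 2·sin(u)·α²·(1−α²)·(1−cos u) / |1−w|⁴; in particular this imaginary part is strictly positive. -/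
/-- for `α ∈ (0,1)`, `u ∈ (0,π)` and `w = α e^{iu}`,
`Im[(w/(1−w))·(1 − α² − (1−α)²/(1−w))] = 2 sin(u) α² (1−α²)(1−cos u)/|1−w|⁴`,
and in particular this imaginary part is strictly positive. -/
theorem steep_descent_imaginary_part (α u : ℝ) (hα : α ∈ Set.Ioo (0 : ℝ) 1)
    (hu : u ∈ Set.Ioo 0 Real.pi) :
    ((((α : ℂ) * Complex.exp (u * Complex.I)) / (1 - (α : ℂ) * Complex.exp (u * Complex.I))) *
        (1 - (α : ℂ) ^ 2 - (1 - (α : ℂ)) ^ 2 / (1 - (α : ℂ) * Complex.exp (u * Complex.I)))).im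
      = 2 * Real.sin u * α ^ 2 * (1 - α ^ 2) * (1 - Real.cos u) /
          ‖1 - (α : ℂ) * Complex.exp (u * Complex.I)‖ ^ 4 ∧
    0 < ((((α : ℂ) * Complex.exp (u * Complex.I)) /
          (1 - (α : ℂ) * Complex.exp (u * Complex.I))) *
        (1 - (α : ℂ) ^ 2 - (1 - (α : ℂ)) ^ 2 /
          (1 - (α : ℂ) * Complex.exp (u * Complex.I)))).im := by
  obtain ⟨ha0, ha1⟩ := hα
  have hs : 0 < Real.sin u := Real.sin_pos_of_pos_of_lt_pi hu.1 hu.2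
  have hsc : Real.sin u ^ 2 + Real.cos u ^ 2 = 1 := Real.sin_sq_add_cos_sq u
  have hc : Real.cos u < 1 := by nlinarith [Real.cos_le_one u]
  have hre : (Complex.exp (u * Complex.I)).re = Real.cos u := Complex.exp_ofReal_mul_I_re u
  have him : (Complex.exp (u * Complex.I)).im = Real.sin u := Complex.exp_ofReal_mul_I_im u
  generalize Complex.exp (u * Complex.I) = e at *
  generalize Real.cos u = c at *
  generalize Real.sin u = s at *
  have hN : ‖1 - (α : ℂ) * e‖ ^ 2 = 1 - 2 * α * c + α ^ 2 := by
    rw [← Complex.normSq_eq_norm_sq, Complex.normSq_apply]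
    simp [hre, him]
    linear_combination α ^ 2 * hsc
  have hNpos : 0 < 1 - 2 * α * c + α ^ 2 := by nlinarith [sq_nonneg (1 - α)]
  have hz : (1 - (α : ℂ) * e) ≠ 0 := by
    intro h
    rw [h] at hN
    simp at hN
    linarith
  have he : e = (c : ℂ) + s * Complex.I := by
    apply Complex.ext <;> simp [hre, him]
  have hN4 : ‖1 - (α : ℂ) * e‖ ^ 4 = (1 - 2 * α * c + α ^ 2) ^ 2 := by
    rw [← hN]; ring
  -- multiply by the conjugate of the denominator
  have hzz : (1 - (α : ℂ) * e) * (1 - (α : ℂ) * ((c : ℂ) - s * Complex.I))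
      = ((1 - 2 * α * c + α ^ 2 : ℝ) : ℂ) := by
    apply Complex.ext
    · simp [hre, him, pow_two]
      linear_combination α ^ 2 * hsc
    · simp [hre, him, pow_two]
      ring
  have hNC : ((1 - 2 * α * c + α ^ 2 : ℝ) : ℂ) ≠ 0 := by
    exact_mod_cast hNpos.ne'
  have hinv : (1 - (α : ℂ) * e)⁻¹
      = (1 - (α : ℂ) * ((c : ℂ) - s * Complex.I)) * (((1 - 2 * α * c + α ^ 2)⁻¹ : ℝ) : ℂ) := by
    rw [Complex.ofReal_inv, ← div_eq_mul_inv, eq_div_iff hNC, ← hzz, inv_mul_cancel_left₀ hz]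
  have key : (((α : ℂ) * e) / (1 - (α : ℂ) * e) *
      (1 - (α : ℂ) ^ 2 - (1 - (α : ℂ)) ^ 2 / (1 - (α : ℂ) * e))).im
      = 2 * s * α ^ 2 * (1 - α ^ 2) * (1 - c) / ‖1 - (α : ℂ) * e‖ ^ 4 := by
    rw [hN4, div_eq_mul_inv, div_eq_mul_inv ((1 - (α : ℂ)) ^ 2), hinv]
    have hM : (1 - 2 * α * c + α ^ 2) * (1 - 2 * α * c + α ^ 2)⁻¹ = 1 :=
      mul_inv_cancel₀ hNpos.ne'
    rw [div_eq_mul_inv, ← inv_pow]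
    generalize (1 - 2 * α * c + α ^ 2)⁻¹ = m at *
    simp [hre, him, pow_two]
    linear_combination (-(1 - α ^ 2) * α * s * m) * hM + ((1 - α) ^ 2 * m ^ 2 * α ^ 3 * s) * hsc
  refine ⟨key, ?_⟩
  rw [key, hN4]
  have h1 : 0 < 1 - α ^ 2 := by nlinarith
  have h2 : 0 < 1 - c := by linarith
  positivity
end
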